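/- Γ-liminf inequality: Let E ⊂ ℝ be a bounded open interval and let v : E → {α', β'} be a step function with exactly N jump points, i.e. there are points inf E = t₀ < t₁ < ⋯ < t_N < t_{N+1} = sup E such that v is constant on each (t_i, t_{i+1}) and takes different values on consecutive subintervals. Then for every sequence ε_n → 0⁺ and every sequence of measurable functions v_n with v_n → v in L¹(E), one has liminf_{n→∞} G_{ε_n}[v_n, E] ≥ N · κ_s, where κ_s := inf{ G₁[v, ℝ] : v measurable with G₁[v, ℝ] < ∞, v(x) → α' as x → −∞, v(x) → β' as x → +∞ }. -/

import Mathlib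

open Real MeasureTheory Set Filter
open scoped ENNReal

/-- The Gagliardo-type double integral ∬_{E×E} |v(x') − v(x)|²/|x' − x|^{1+2s} dx' dx. -/
noncomputable def gag (s : ℝ) (E : Set ℝ) (v : ℝ → ℝ) : ℝ≥0∞ :=
  ∫⁻ x in E, ∫⁻ x' in E, ENNReal.ofReal ((v x' - v x) ^ 2 / |x' - x| ^ (1 + 2 * s))

/-- The functional
G_ε[v, E] := (ε^{1−a}/D) ∬_{E×E} |v(x')−v(x)|²/|x'−x|^{1+2s} + ε^{−(1−a)/(−a)} ∫_E V(v). -/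
noncomputable def Gfun (a s D : ℝ) (V : ℝ → ℝ) (ε : ℝ) (E : Set ℝ) (v : ℝ → ℝ) : ℝ≥0∞ :=
  ENNReal.ofReal (ε ^ (1 - a) / D) * gag s E v +
    ENNReal.ofReal (ε ^ (-((1 - a) / (-a)))) * ∫⁻ x in E, ENNReal.ofReal (V (v x))

/-- The functional G₁[v, ℝ] := (1/D) ∬ |v(x)−v(x')|²/|x−x'|^{1+2s} + ∫ V(v). -/
noncomputable def Gone (D s : ℝ) (V : ℝ → ℝ) (v : ℝ → ℝ) : ℝ≥0∞ :=
  ENNReal.ofReal (1 / D) * gag s univ v + ∫⁻ x, ENNReal.ofReal (V (v x))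

/-- The optimal-profile constant
κ_s := inf { G₁[v, ℝ] : v measurable, G₁[v, ℝ] < ∞, v → α' at −∞, v → β' at +∞ }. -/
noncomputable def kappa (D s α' β' : ℝ) (V : ℝ → ℝ) : ℝ≥0∞ :=
  sInf {t : ℝ≥0∞ | ∃ v : ℝ → ℝ, Measurable v ∧ Gone D s V v ≠ ⊤ ∧
    Tendsto v atBot (nhds α') ∧ Tendsto v atTop (nhds β') ∧ t = Gone D s V v}


lemma setLIntegral_comp_affine {c : ℝ} (hc : c ≠ 0) (d : ℝ) (I : Set ℝ) (g : ℝ → ℝ≥0∞) :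
    ∫⁻ x in (fun x => c * x + d) ⁻¹' I, g (c * x + d) =
      ENNReal.ofReal |c|⁻¹ * ∫⁻ y in I, g y := by
  have he : MeasurableEmbedding (fun x : ℝ => c * x + d) :=
    (measurableEmbedding_addRight d).comp (measurableEmbedding_mulLeft₀ hc)
  have hm : Measure.map (fun x : ℝ => c * x + d) volume = ENNReal.ofReal |c|⁻¹ • volume := by
    have h1 : (fun x : ℝ => c * x + d) = (fun x => x + d) ∘ (fun x => c * x) := rfl
    rw [h1, ← Measure.map_map (by fun_prop) (by fun_prop), Real.map_volume_mul_left hc,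
      Measure.map_smul, map_add_right_eq_self, abs_inv]
  rw [← he.lintegral_map, ← he.restrict_map, hm, Measure.restrict_smul, lintegral_smul_measure,
    smul_eq_mul]

lemma gag_comp_affine (s : ℝ) {c : ℝ} (hc : c ≠ 0) (d : ℝ) (I : Set ℝ) (f : ℝ → ℝ) :
    gag s ((fun x => c * x + d) ⁻¹' I) (fun x => f (c * x + d)) =
      ENNReal.ofReal (|c| ^ (2 * s - 1)) * gag s I f := by
  have hc' : 0 < |c| := abs_pos.2 hc
  have hk : ∀ x y : ℝ, ENNReal.ofReal ((f (c * y + d) - f (c * x + d)) ^ 2 / |y - x| ^ (1 + 2 * s))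
      = ENNReal.ofReal (|c| ^ (1 + 2 * s)) * ENNReal.ofReal ((f (c * y + d) - f (c * x + d)) ^ 2 /
        |(c * y + d) - (c * x + d)| ^ (1 + 2 * s)) := by
    intro x y
    rw [← ENNReal.ofReal_mul (by positivity)]
    congr 1
    have : (c * y + d) - (c * x + d) = c * (y - x) := by ring
    rw [this, abs_mul, Real.mul_rpow (abs_nonneg _) (abs_nonneg _)]
    have : |c| ^ (1 + 2 * s) ≠ 0 := by positivity
    field_simp
  unfold gag
  simp_rw [hk]
  simp_rw [lintegral_const_mul' _ _ ENNReal.ofReal_ne_top]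
  have hin : ∀ x : ℝ, ∫⁻ y in (fun y => c * y + d) ⁻¹' I, ENNReal.ofReal
      ((f (c * y + d) - f (c * x + d)) ^ 2 / |(c * y + d) - (c * x + d)| ^ (1 + 2 * s)) =
      ENNReal.ofReal |c|⁻¹ * ∫⁻ y in I, ENNReal.ofReal
        ((f y - f (c * x + d)) ^ 2 / |y - (c * x + d)| ^ (1 + 2 * s)) := fun x =>
    setLIntegral_comp_affine hc d I (fun y => ENNReal.ofReal ((f y - f (c * x + d)) ^ 2 /
        |y - (c * x + d)| ^ (1 + 2 * s)))
  simp_rw [hin]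
  simp_rw [lintegral_const_mul' _ _ ENNReal.ofReal_ne_top]
  rw [setLIntegral_comp_affine hc d I (fun x => ∫⁻ y in I, ENNReal.ofReal ((f y - f x) ^ 2 /
        |y - x| ^ (1 + 2 * s)))]
  rw [← mul_assoc, ← mul_assoc, ← ENNReal.ofReal_mul (by positivity),
    ← ENNReal.ofReal_mul (by positivity)]
  congr 2
  rw [← Real.rpow_neg_one, ← Real.rpow_add hc', ← Real.rpow_add hc']
  congr 1
  ring

/-- The linear transition from `0` to `1` on the unit interval. -/
noncomputable def ramp (x : ℝ) : ℝ := max 0 (min 1 x)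

lemma continuous_ramp : Continuous ramp := by unfold ramp; fun_prop

lemma ramp_nonneg (x : ℝ) : 0 ≤ ramp x := le_max_left _ _

lemma ramp_le_one (x : ℝ) : ramp x ≤ 1 := max_le zero_le_one (min_le_left _ _)

lemma ramp_of_nonpos {x : ℝ} (h : x ≤ 0) : ramp x = 0 := max_eq_left ((min_le_right _ _).trans h)

lemma ramp_of_one_le {x : ℝ} (h : 1 ≤ x) : ramp x = 1 := by simp [ramp, h]

lemma monotone_ramp : Monotone ramp := fun _ _ h => max_le_max le_rfl (min_le_min le_rfl h)

lemma abs_ramp_sub_le (x y : ℝ) : |ramp x - ramp y| ≤ |x - y| := by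
  unfold ramp
  exact (abs_max_sub_max_le_max _ _ _ _).trans (max_le (by simp)
    ((abs_min_sub_min_le_max _ _ _ _).trans (max_le (by simp) le_rfl)))

lemma gag_ramp_ne_top {s : ℝ} (hs : 1 / 2 < s) (hs1 : s < 1) : gag s univ ramp ≠ ⊤ := by
  set φ : ℝ → ℝ := fun t => if t ≤ 1 then 3 * t ^ (1 - 2 * s) else 3 * t ^ (-(2 * s)) with hφ
  have hφi : IntegrableOn φ (Ioi 0) := by
    rw [← Ioc_union_Ioi_eq_Ioi (zero_le_one (α := ℝ))]
    refine IntegrableOn.union ?_ ?_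
    · have : IntegrableOn (fun t : ℝ => 3 * t ^ (1 - 2 * s)) (Ioc 0 1) :=
        ((intervalIntegrable_iff_integrableOn_Ioc_of_le zero_le_one).1
          (intervalIntegral.intervalIntegrable_rpow' (by linarith))).const_mul 3
      refine this.congr_fun (fun t ht => ?_) measurableSet_Ioc
      simp [hφ, ht.2]
    · have : IntegrableOn (fun t : ℝ => 3 * t ^ (-(2 * s))) (Ioi 1) :=
        (integrableOn_Ioi_rpow_of_lt (by linarith) one_pos).const_mul 3
      refine this.congr_fun (fun t ht => ?_) measurableSet_Ioi
      simp [hφ, not_le.2 (mem_Ioi.1 ht)]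
  have hφa : Integrable (fun h => φ |h|) := by
    rw [← integrableOn_univ, ← Iic_union_Ioi (a := (0 : ℝ))]
    refine IntegrableOn.union ?_ (hφi.congr_fun (fun x hx => ?_) measurableSet_Ioi)
    · rw [integrableOn_Iic_iff_integrableOn_Iio]
      have h1 : IntegrableOn (fun x => φ (-x)) (Iio 0) := by
        simpa [Function.comp_def] using (MeasurePreserving.integrableOn_comp_preimage
          (Measure.measurePreserving_neg volume) (Homeomorph.neg ℝ).measurableEmbedding).2 hφi
      exact h1.congr_fun (fun x hx => by simp only [abs_of_neg (mem_Iio.1 hx)]) measurableSet_Iio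
    · simp only [abs_of_pos (mem_Ioi.1 hx)]
  have hin : ∀ h : ℝ, ∫⁻ x, ENNReal.ofReal ((ramp (x + h) - ramp x) ^ 2 / |h| ^ (1 + 2 * s)) ≤
      ENNReal.ofReal (φ |h|) := by
    intro h
    rcases eq_or_ne h 0 with rfl | hh
    · simp
    have hh' : 0 < |h| := abs_pos.2 hh
    have hb : ∀ x, ENNReal.ofReal ((ramp (x + h) - ramp x) ^ 2 / |h| ^ (1 + 2 * s)) ≤
        (Icc (-|h|) (1 + |h|)).indicator
          (fun _ => ENNReal.ofReal (min 1 (|h| ^ 2) / |h| ^ (1 + 2 * s))) x := by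
      intro x
      by_cases hx : x ∈ Icc (-|h|) (1 + |h|)
      · rw [indicator_of_mem hx]
        gcongr
        refine le_min ?_ ?_
        · rw [← sq_abs]
          refine pow_le_one₀ (abs_nonneg _) ?_
          rw [abs_le]
          constructor <;> linarith [ramp_nonneg x, ramp_nonneg (x + h), ramp_le_one x,
            ramp_le_one (x + h)]
        · rw [← sq_abs]
          have := abs_ramp_sub_le (x + h) x
          rw [add_sub_cancel_left] at this
          gcongr
      · have : ramp (x + h) = ramp x := by
          rw [mem_Icc, not_and_or, not_le, not_le] at hx
          rcases hx with hx | hx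
          · rw [ramp_of_nonpos, ramp_of_nonpos] <;> linarith [le_abs_self h, neg_abs_le h]
          · rw [ramp_of_one_le, ramp_of_one_le] <;> linarith [le_abs_self h, neg_abs_le h]
        simp [this]
    refine (lintegral_mono hb).trans ?_
    rw [lintegral_indicator measurableSet_Icc, setLIntegral_const, Real.volume_Icc,
      ← ENNReal.ofReal_mul (by positivity)]
    apply ENNReal.ofReal_le_ofReal
    simp only [hφ]
    split_ifs with h1
    · have e1 : |h| ^ (1 - 2 * s) = |h| ^ 2 / |h| ^ (1 + 2 * s) := by
        rw [← Real.rpow_natCast, ← Real.rpow_sub hh']; congr 1; push_cast; ring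
      rw [e1, mul_comm]
      gcongr
      · linarith
      · exact min_le_right _ _
    · push Not at h1
      have e1 : |h| ^ (-(2 * s)) = |h| * (1 / |h| ^ (1 + 2 * s)) := by
        rw [mul_one_div]
        nth_rw 2 [← Real.rpow_one |h|]
        rw [← Real.rpow_sub hh']; congr 1; ring
      rw [e1, mul_comm, ← mul_assoc]
      gcongr
      · linarith
      · exact min_le_left _ _
  have hmain : gag s univ ramp ≤ ∫⁻ h, ENNReal.ofReal (φ |h|) := by
    unfold gag
    simp only [Measure.restrict_univ]
    have h1 : ∀ x : ℝ, ∫⁻ y, ENNReal.ofReal ((ramp y - ramp x) ^ 2 / |y - x| ^ (1 + 2 * s)) =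
        ∫⁻ h, ENNReal.ofReal ((ramp (x + h) - ramp x) ^ 2 / |h| ^ (1 + 2 * s)) := by
      intro x
      rw [← lintegral_add_left_eq_self _ x]
      simp
    simp_rw [h1]
    rw [lintegral_lintegral_swap]
    · exact lintegral_mono hin
    · have := continuous_ramp.measurable
      apply Measurable.aemeasurable
      simp only [Function.uncurry_def]
      fun_prop
  refine (hmain.trans_lt ?_).ne
  exact hφa.lintegral_lt_top

lemma exists_window (f : ℝ → ℝ≥0∞) {lo hi l : ℝ} (hl : 0 < l) (hlh : l ≤ hi - lo) :
    ∃ p, lo ≤ p ∧ p + l ≤ hi ∧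
      ∫⁻ x in Ioo p (p + l), f x ≤
        ENNReal.ofReal (2 * l / (hi - lo)) * ∫⁻ x in Ioo lo hi, f x := by
  set k : ℕ := ⌊(hi - lo) / l⌋₊ with hk
  have hk1 : 1 ≤ k := by
    rw [hk, Nat.one_le_floor_iff, one_le_div hl]; exact hlh
  have hkl : k * l ≤ hi - lo := by
    rw [← le_div_iff₀ hl]; exact Nat.floor_le (div_nonneg (hl.le.trans hlh) hl.le)
  have hkl' : hi - lo ≤ 2 * k * l := by
    have h1 : (hi - lo) / l < k + 1 := Nat.lt_floor_add_one _
    have h2 : (1 : ℝ) ≤ k := by exact_mod_cast hk1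
    rw [div_lt_iff₀ hl] at h1
    nlinarith
  set J : ℕ → Set ℝ := fun j => Ioo (lo + j * l) (lo + j * l + l) with hJ
  have hd : Pairwise (Function.onFun Disjoint J) := by
    have key : ∀ i j : ℕ, i < j → Disjoint (J i) (J j) := by
      intro i j hij
      rw [Set.disjoint_left]
      intro x hx hy
      have : (i : ℝ) + 1 ≤ j := by exact_mod_cast hij
      have := hx.2
      have := hy.1
      nlinarith
    intro i j hij
    rcases lt_or_gt_of_ne hij with h | h
    · exact key i j h
    · exact (key j i h).symm
  have hsum : ∑ j ∈ Finset.range k, ∫⁻ x in J j, f x ≤ ∫⁻ x in Ioo lo hi, f x := by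
    rw [← lintegral_biUnion_finset (hd.set_pairwise _) (fun _ _ => measurableSet_Ioo)]
    apply lintegral_mono_set
    simp only [iUnion_subset_iff, Finset.mem_range]
    intro j hj x hx
    have : (j : ℝ) + 1 ≤ k := by exact_mod_cast hj
    have := hx.2
    have := hx.1
    have : (0 : ℝ) ≤ j * l := by positivity
    constructor <;> nlinarith
  obtain ⟨j, hj, hjle⟩ : ∃ j ∈ Finset.range k,
      ∫⁻ x in J j, f x ≤ (k : ℝ≥0∞)⁻¹ * ∫⁻ x in Ioo lo hi, f x := by
    obtain ⟨j, hj, hmin⟩ := Finset.exists_min_image (Finset.range k)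
      (fun j => ∫⁻ x in J j, f x) (Finset.nonempty_range_iff.2 (by omega))
    refine ⟨j, hj, ?_⟩
    rw [mul_comm, ← div_eq_mul_inv, ENNReal.le_div_iff_mul_le (.inl (by
      exact_mod_cast (by omega : k ≠ 0))) (.inl (ENNReal.natCast_ne_top k)), mul_comm]
    refine le_trans ?_ hsum
    simpa using Finset.card_nsmul_le_sum _ _ _ hmin
  have hj' : (j : ℝ) + 1 ≤ k := by exact_mod_cast Finset.mem_range.1 hj
  refine ⟨lo + j * l, by have : (0 : ℝ) ≤ j * l := by positivity
                         linarith, by nlinarith, hjle.trans ?_⟩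
  gcongr
  have hk0 : (0 : ℝ) < k := by exact_mod_cast hk1
  rw [← ENNReal.ofReal_natCast, ← ENNReal.ofReal_inv_of_pos hk0]
  apply ENNReal.ofReal_le_ofReal
  rw [inv_eq_one_div, div_le_div_iff₀ hk0 (by linarith)]
  linarith

/-- The affine transition from `α` to `β` on `[p, p + l]`, constant elsewhere. -/
noncomputable def transition (α β l p x : ℝ) : ℝ := α + (β - α) * ramp ((x - p) / l)

section transition

variable {α β l p x : ℝ}

lemma continuous_transition : Continuous (transition α β l p) := by
  have := continuous_ramp
  unfold transition
  fun_prop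

lemma le_transition (h : α ≤ β) : α ≤ transition α β l p x := by
  have := mul_nonneg (sub_nonneg.2 h) (ramp_nonneg ((x - p) / l))
  unfold transition
  linarith

lemma transition_le (h : α ≤ β) : transition α β l p x ≤ β := by
  have := mul_le_mul_of_nonneg_left (ramp_le_one ((x - p) / l)) (sub_nonneg.2 h)
  unfold transition
  linarith

lemma transition_of_le (hl : 0 < l) (hx : x ≤ p) : transition α β l p x = α := by
  rw [transition, ramp_of_nonpos (div_nonpos_of_nonpos_of_nonneg (by linarith) hl.le)]
  ring

lemma transition_of_ge (hl : 0 < l) (hx : p + l ≤ x) : transition α β l p x = β := by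
  rw [transition, ramp_of_one_le ((one_le_div hl).2 (by linarith))]
  ring

lemma transition_anti (h : α ≤ β) (hl : 0 < l) {q : ℝ} (hpq : p ≤ q) :
    transition α β l q x ≤ transition α β l p x := by
  have : ramp ((x - q) / l) ≤ ramp ((x - p) / l) := monotone_ramp (by gcongr)
  have := mul_le_mul_of_nonneg_left this (sub_nonneg.2 h)
  unfold transition
  linarith

end transition

lemma gag_transition (s α β : ℝ) {l : ℝ} (hl : 0 < l) (p : ℝ) :
    gag s univ (transition α β l p) =
      ENNReal.ofReal (l ^ (1 - 2 * s) * (β - α) ^ 2) * gag s univ ramp := by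
  have h1 := gag_comp_affine s (inv_ne_zero hl.ne') (-(p / l)) univ
    (fun z => α + (β - α) * ramp z)
  have h2 : (fun x => α + (β - α) * ramp (l⁻¹ * x + -(p / l))) = transition α β l p := by
    funext x
    unfold transition
    congr 3
    field_simp
    ring
  have h3 : gag s univ (fun z => α + (β - α) * ramp z) =
      ENNReal.ofReal ((β - α) ^ 2) * gag s univ ramp := by
    unfold gag
    rw [← lintegral_const_mul' _ _ ENNReal.ofReal_ne_top]
    congr 1 with x
    rw [← lintegral_const_mul' _ _ ENNReal.ofReal_ne_top]
    congr 1 with y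
    rw [← ENNReal.ofReal_mul (by positivity)]
    congr 1
    ring
  rw [h2, h3, preimage_univ, ← mul_assoc, ← ENNReal.ofReal_mul (by positivity)] at h1
  rw [h1, abs_of_pos (inv_pos.2 hl), Real.inv_rpow hl.le, ← Real.rpow_neg hl.le]
  congr 4
  ring

/-- The function `v` truncated to `[α, β]` and forced to equal `α` to the left of `p` and `β` to
the right of `q + l`. -/
noncomputable def splice (α β l p q : ℝ) (v : ℝ → ℝ) (x : ℝ) : ℝ :=
  max (min (v x) (transition α β l p x)) (transition α β l q x)

section splice

variable {α β l p q : ℝ} {v : ℝ → ℝ}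

lemma measurable_splice (hv : Measurable v) : Measurable (splice α β l p q v) :=
  (hv.min continuous_transition.measurable).max continuous_transition.measurable

lemma splice_of_le (hl : 0 < l) (hpq : p ≤ q) {x : ℝ} (hx : x ≤ p) :
    splice α β l p q v x = α := by
  rw [splice, transition_of_le hl hx, transition_of_le hl (hx.trans hpq)]
  exact max_eq_right (min_le_right _ _)

lemma splice_of_ge (h : α ≤ β) (hl : 0 < l) {x : ℝ} (hx : q + l ≤ x) :
    splice α β l p q v x = β := by
  rw [splice, transition_of_ge hl hx]
  exact max_eq_right ((min_le_right _ _).trans (transition_le h))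

lemma sq_splice_sub_le (h : α ≤ β) (hl : 0 < l) (hpq : p ≤ q) {lo hi : ℝ} (hlo : lo ≤ p)
    (hhi : q + l ≤ hi) (x y : ℝ) (hxy : ¬ (x ∈ Ioo lo hi ∧ y ∈ Ioo lo hi)) :
    (splice α β l p q v y - splice α β l p q v x) ^ 2 ≤
      (transition α β l p y - transition α β l p x) ^ 2 +
        (transition α β l q y - transition α β l q x) ^ 2 := by
  have key : ∀ x y : ℝ, x ∉ Ioo lo hi →
      (splice α β l p q v y - splice α β l p q v x) ^ 2 ≤
      (transition α β l p y - transition α β l p x) ^ 2 +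
        (transition α β l q y - transition α β l q x) ^ 2 := by
    intro x y hx
    have h1 : transition α β l q y ≤ splice α β l p q v y := le_max_right _ _
    have h2 : splice α β l p q v y ≤ transition α β l p y :=
      max_le (min_le_right _ _) (transition_anti h hl hpq)
    have h3 := le_transition (l := l) (p := q) (x := y) h
    have h4 := transition_le (l := l) (p := p) (x := y) h
    rw [mem_Ioo, not_and_or, not_lt, not_lt] at hx
    rcases hx with hx | hx
    · have hxp := hx.trans hlo
      rw [splice_of_le hl hpq hxp, transition_of_le hl hxp, transition_of_le hl (hxp.trans hpq)]
      nlinarith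
    · have hxq := hhi.trans hx
      rw [splice_of_ge h hl hxq, transition_of_ge hl hxq,
        transition_of_ge (p := p) hl ((by linarith : p + l ≤ q + l).trans hxq)]
      nlinarith
  rcases not_and_or.1 hxy with hx | hy
  · exact key x y hx
  · have := key y x hy
    linarith [sub_sq_comm (splice α β l p q v y) (splice α β l p q v x),
      sub_sq_comm (transition α β l p y) (transition α β l p x),
      sub_sq_comm (transition α β l q y) (transition α β l q x)]

lemma sq_splice_sub_le_add (x y : ℝ) :
    (splice α β l p q v y - splice α β l p q v x) ^ 2 ≤
      (v y - v x) ^ 2 + ((transition α β l p y - transition α β l p x) ^ 2 +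
        (transition α β l q y - transition α β l q x) ^ 2) := by
  have h1 : |splice α β l p q v y - splice α β l p q v x| ≤
      max (max |v y - v x| |transition α β l p y - transition α β l p x|)
        |transition α β l q y - transition α β l q x| :=
    (abs_max_sub_max_le_max _ _ _ _).trans
      (max_le_max (abs_min_sub_min_le_max _ _ _ _) le_rfl)
  have h2 := sq_nonneg (v y - v x)
  have h3 := sq_nonneg (transition α β l p y - transition α β l p x)
  have h4 := sq_nonneg (transition α β l q y - transition α β l q x)
  rcases le_max_iff.1 h1 with h | h
  · rcases le_max_iff.1 h with h | h
    · linarith [sq_le_sq.2 h]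
    · linarith [sq_le_sq.2 h]
  · linarith [sq_le_sq.2 h]

lemma gag_splice_le (s : ℝ) (h : α ≤ β) (hl : 0 < l) (hpq : p ≤ q)
    {lo hi : ℝ} (hlo : lo ≤ p) (hhi : q + l ≤ hi) :
    gag s univ (splice α β l p q v) ≤ gag s (Ioo lo hi) v +
      (gag s univ (transition α β l p) + gag s univ (transition α β l q)) := by
  set K : (ℝ → ℝ) → ℝ → ℝ → ℝ≥0∞ := fun f x y =>
    ENNReal.ofReal ((f y - f x) ^ 2 / |y - x| ^ (1 + 2 * s)) with hK
  have hKm : ∀ f : ℝ → ℝ, Measurable f → Measurable (Function.uncurry (K f)) := by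
    intro f hf
    simp only [hK, Function.uncurry_def]
    fun_prop
  have hKm1 : ∀ f : ℝ → ℝ, Measurable f → ∀ x, Measurable (K f x) := fun f hf x =>
    (hKm f hf).of_uncurry_left
  have hKm2 : ∀ f : ℝ → ℝ, Measurable f → Measurable (fun x => ∫⁻ y, K f x y) := fun f hf =>
    (hKm f hf).lintegral_prod_right'
  have ht : ∀ r, Measurable (transition α β l r) := fun r => continuous_transition.measurable
  have hpt : ∀ x y, K (splice α β l p q v) x y ≤
      (Ioo lo hi).indicator (fun x => (Ioo lo hi).indicator (K v x) y) x +
        (K (transition α β l p) x y + K (transition α β l q) x y) := by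
    intro x y
    have hd : 0 ≤ |y - x| ^ (1 + 2 * s) := by positivity
    have e : K (transition α β l p) x y + K (transition α β l q) x y = ENNReal.ofReal
        (((transition α β l p y - transition α β l p x) ^ 2 +
          (transition α β l q y - transition α β l q x) ^ 2) / |y - x| ^ (1 + 2 * s)) := by
      rw [add_div, ENNReal.ofReal_add (by positivity) (by positivity)]
    by_cases hxy : x ∈ Ioo lo hi ∧ y ∈ Ioo lo hi
    · rw [indicator_of_mem hxy.1, indicator_of_mem hxy.2, e, hK,
        ← ENNReal.ofReal_add (by positivity) (by positivity), ← add_div]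
      exact ENNReal.ofReal_le_ofReal (div_le_div_of_nonneg_right (sq_splice_sub_le_add x y) hd)
    · rw [e]
      exact (ENNReal.ofReal_le_ofReal (div_le_div_of_nonneg_right
        (sq_splice_sub_le h hl hpq hlo hhi x y hxy) hd)).trans le_add_self
  have hg : ∀ f, gag s univ f = ∫⁻ x, ∫⁻ y, K f x y := by
    intro f
    simp only [gag, Measure.restrict_univ, hK]
  have hg' : gag s (Ioo lo hi) v = ∫⁻ x, ∫⁻ y,
      (Ioo lo hi).indicator (fun x => (Ioo lo hi).indicator (K v x) y) x := by
    rw [gag, ← lintegral_indicator measurableSet_Ioo]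
    congr 1 with x
    by_cases hx : x ∈ Ioo lo hi
    · simp only [indicator_of_mem hx]
      rw [lintegral_indicator measurableSet_Ioo]
    · simp [indicator_of_notMem hx]
  have hm2 : Measurable fun x => (∫⁻ y, K (transition α β l p) x y) +
      ∫⁻ y, K (transition α β l q) x y := (hKm2 _ (ht p)).add (hKm2 _ (ht q))
  have hm1 : ∀ x, Measurable fun y => K (transition α β l p) x y + K (transition α β l q) x y :=
    fun x => (hKm1 _ (ht p) x).add (hKm1 _ (ht q) x)
  rw [hg, hg, hg, hg', ← lintegral_add_left (hKm2 _ (ht p)), ← lintegral_add_right _ hm2]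
  refine lintegral_mono fun x => ?_
  rw [← lintegral_add_left (hKm1 _ (ht p) x), ← lintegral_add_right _ (hm1 x)]
  exact lintegral_mono (hpt x)

lemma lintegral_potential_splice_le {V : ℝ → ℝ} (hV0 : ∀ t, 0 ≤ V t) (hVα : V α = 0)
    (hVβ : V β = 0) (hv : Measurable v) (h : α ≤ β) (hl : 0 < l)
    (hpq : p + l ≤ q) {lo hi : ℝ} (hlo : lo ≤ p) (hhi : q + l ≤ hi) {η C : ℝ}
    (hC : 0 ≤ C) (hVη : ∀ t ∈ Icc α β, V t ≤ η + C * (t - α) ∧ V t ≤ η + C * (β - t)) :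
    ∫⁻ x, ENNReal.ofReal (V (splice α β l p q v x)) ≤
      (∫⁻ x in Ioo lo hi, ENNReal.ofReal (V (v x))) +
        ((∫⁻ x in Ioo p (p + l), ENNReal.ofReal (η + C * |v x - α|)) +
          ∫⁻ x in Ioo q (q + l), ENNReal.ofReal (η + C * |v x - β|)) := by
  have hm : ∀ c r : ℝ, Measurable
      ((Ioo r (r + l)).indicator fun x => ENNReal.ofReal (η + C * |v x - c|)) := fun c r =>
    Measurable.indicator (by fun_prop) measurableSet_Ioo
  have hm' : Measurable fun x =>
      (Ioo p (p + l)).indicator (fun x => ENNReal.ofReal (η + C * |v x - α|)) x +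
        (Ioo q (q + l)).indicator (fun x => ENNReal.ofReal (η + C * |v x - β|)) x :=
    (hm α p).add (hm β q)
  rw [← lintegral_indicator measurableSet_Ioo, ← lintegral_indicator measurableSet_Ioo,
    ← lintegral_indicator measurableSet_Ioo, ← lintegral_add_right _ (hm β q),
    ← lintegral_add_right _ hm']
  refine lintegral_mono fun x => ?_
  rcases le_or_gt x p with h1 | h1
  · simp [splice_of_le hl (by linarith : p ≤ q) h1, hVα]
  rcases lt_or_ge x (p + l) with h2 | h2
  · refine le_trans ?_ (le_add_self.trans' le_self_add)
    rw [indicator_of_mem (show x ∈ Ioo p (p + l) from ⟨h1, h2⟩)]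
    apply ENNReal.ofReal_le_ofReal
    have hs : splice α β l p q v x = max (min (v x) (transition α β l p x)) α := by
      rw [splice, transition_of_le (p := q) hl (by linarith)]
    have hb : splice α β l p q v x ≤ β := hs ▸ max_le ((min_le_right _ _).trans (transition_le h)) h
    have ha : α ≤ splice α β l p q v x := hs ▸ le_max_right _ _
    refine (hVη _ ⟨ha, hb⟩).1.trans ?_
    gcongr
    rw [hs, sub_le_iff_le_add]
    exact max_le ((min_le_left _ _).trans (by linarith [le_abs_self (v x - α)]))
      (by linarith [abs_nonneg (v x - α)])
  rcases le_or_gt x q with h3 | h3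
  · refine le_trans ?_ le_self_add
    rw [indicator_of_mem (show x ∈ Ioo lo hi from ⟨by linarith, by linarith⟩)]
    apply ENNReal.ofReal_le_ofReal
    rw [splice, transition_of_ge hl h2, transition_of_le hl h3]
    rcases min_choice (v x) β with e | e <;> rw [e]
    · rcases max_choice (v x) α with e | e <;> rw [e]
      rw [hVα]; exact hV0 _
    · rw [max_eq_left h, hVβ]; exact hV0 _
  rcases lt_or_ge x (q + l) with h4 | h4
  · refine le_trans ?_ (le_add_self.trans' le_add_self)
    rw [indicator_of_mem (show x ∈ Ioo q (q + l) from ⟨h3, h4⟩)]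
    apply ENNReal.ofReal_le_ofReal
    have hs : splice α β l p q v x = max (min (v x) β) (transition α β l q x) := by
      rw [splice, transition_of_ge (p := p) hl h2]
    have hb : splice α β l p q v x ≤ β := hs ▸ max_le (min_le_right _ _) (transition_le h)
    have ha : α ≤ splice α β l p q v x := hs ▸ (le_transition h).trans (le_max_right _ _)
    refine (hVη _ ⟨ha, hb⟩).2.trans ?_
    gcongr
    rw [hs, sub_le_comm]
    refine le_trans ?_ (le_max_left _ _)
    exact le_min (by linarith [neg_abs_le (v x - β)]) (by linarith [abs_nonneg (v x - β)])
  · simp [splice_of_ge h hl h4, hVβ]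

end splice

lemma Gone_comp_mul {a s D ε : ℝ} (V v : ℝ → ℝ) (ha : a < 0) (hs : s = (1 - a) / 2)
    (hD : 0 < D) (hε : 0 < ε) :
    Gone D s V (fun x => v (ε ^ ((1 - a) / (-a)) * x)) = Gfun a s D V ε univ v := by
  have hδ : 0 < ε ^ ((1 - a) / (-a)) := by positivity
  have h1 := gag_comp_affine s hδ.ne' 0 univ v
  have h2 := setLIntegral_comp_affine hδ.ne' 0 univ (fun x => ENNReal.ofReal (V (v x)))
  simp only [add_zero, preimage_univ, abs_of_pos hδ] at h1 h2
  rw [Gone, Gfun, h1, ← mul_assoc, ← ENNReal.ofReal_mul (by positivity),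
    ← setLIntegral_univ, h2, Real.rpow_neg hε.le]
  congr 3
  rw [← Real.rpow_mul hε.le, one_div_mul_eq_div]
  congr 2
  have := ha.ne
  rw [hs]
  field_simp
  ring

lemma kappa_le_Gfun_univ {a s D ε α β : ℝ} {V v : ℝ → ℝ} (ha : a < 0) (hs : s = (1 - a) / 2)
    (hD : 0 < D) (hε : 0 < ε) (hv : Measurable v) (hbot : Tendsto v atBot (nhds α))
    (htop : Tendsto v atTop (nhds β)) :
    kappa D s α β V ≤ Gfun a s D V ε univ v := by
  rcases eq_or_ne (Gfun a s D V ε univ v) ⊤ with hG | hG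
  · rw [hG]; exact le_top
  have hδ : 0 < ε ^ ((1 - a) / (-a)) := by positivity
  rw [← Gone_comp_mul V v ha hs hD hε] at hG ⊢
  exact sInf_le ⟨_, hv.comp (measurable_const_mul _), hG,
    hbot.comp (tendsto_id.const_mul_atBot hδ), htop.comp (tendsto_id.const_mul_atTop hδ), rfl⟩

lemma exists_linear_bound_of_continuous {V : ℝ → ℝ} (hVc : Continuous V) {α β : ℝ}
    (hVα : V α = 0) (hVβ : V β = 0) {η : ℝ} (hη : 0 < η) :
    ∃ C, 0 ≤ C ∧ ∀ t ∈ Icc α β, V t ≤ η + C * (t - α) ∧ V t ≤ η + C * (β - t) := by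
  obtain ⟨M, hM⟩ := (isCompact_Icc (a := α) (b := β)).bddAbove_image hVc.continuousOn
  obtain ⟨r, hr, hr'⟩ := Metric.continuous_iff.1 hVc α η hη
  obtain ⟨u, hu, hu'⟩ := Metric.continuous_iff.1 hVc β η hη
  have hρ : 0 < min r u := lt_min hr hu
  refine ⟨max M 0 / min r u, by positivity, fun t ht => ?_⟩
  have hMt : V t ≤ max M 0 := (hM (mem_image_of_mem V ht)).trans (le_max_left _ _)
  have key : ∀ d : ℝ, 0 ≤ d → (d < min r u → V t < η) → V t ≤ η + max M 0 / min r u * d := by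
    intro d hd h
    rcases lt_or_ge d (min r u) with h1 | h1
    · have : 0 ≤ max M 0 / min r u * d := by positivity
      linarith [h h1]
    · have : max M 0 ≤ max M 0 / min r u * d := by
        rw [div_mul_eq_mul_div, le_div_iff₀ hρ]
        exact mul_le_mul_of_nonneg_left h1 (le_max_right _ _)
      linarith
  refine ⟨key _ (by linarith [ht.1]) fun h => ?_, key _ (by linarith [ht.2]) fun h => ?_⟩
  · have := hr' t (by
      rw [Real.dist_eq, abs_of_nonneg (by linarith [ht.1])]; exact h.trans_le (min_le_left _ _))
    rw [hVα, Real.dist_eq, sub_zero] at this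
    exact (le_abs_self _).trans_lt this
  · have := hu' t (by
      rw [Real.dist_eq, abs_sub_comm, abs_of_nonneg (by linarith [ht.2])]
      exact h.trans_le (min_le_right _ _))
    rw [hVβ, Real.dist_eq, sub_zero] at this
    exact (le_abs_self _).trans_lt this

lemma lintegral_window_le {v : ℝ → ℝ} {α η C p l δ L lo hi : ℝ} (hη : 0 ≤ η)
    (hC : 0 ≤ C) (hδ : 0 < δ) (hL : 0 < L) (hl : l = δ * L) (hlo : lo < hi)
    (hp : ∫⁻ x in Ioo p (p + l), ENNReal.ofReal |v x - α| ≤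
      ENNReal.ofReal (2 * l / (hi - lo)) * ∫⁻ x in Ioo lo hi, ENNReal.ofReal |v x - α|) :
    ENNReal.ofReal δ⁻¹ * ∫⁻ x in Ioo p (p + l), ENNReal.ofReal (η + C * |v x - α|) ≤
      ENNReal.ofReal (η * L) + ENNReal.ofReal (C * (2 * L / (hi - lo))) *
        ∫⁻ x in Ioo lo hi, ENNReal.ofReal |v x - α| := by
  have hlh : 0 < hi - lo := sub_pos.2 hlo
  have h1 : ∫⁻ x in Ioo p (p + l), ENNReal.ofReal (η + C * |v x - α|) =
      ENNReal.ofReal (η * l) +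
        ENNReal.ofReal C * ∫⁻ x in Ioo p (p + l), ENNReal.ofReal |v x - α| := by
    rw [← lintegral_const_mul' _ _ ENNReal.ofReal_ne_top, ENNReal.ofReal_mul hη]
    have : ENNReal.ofReal η * ENNReal.ofReal l =
        ∫⁻ _ in Ioo p (p + l), ENNReal.ofReal η := by
      rw [setLIntegral_const, Real.volume_Ioo, add_sub_cancel_left]
    rw [this, ← lintegral_add_left measurable_const]
    congr 1 with x
    rw [ENNReal.ofReal_add hη (by positivity), ENNReal.ofReal_mul hC]
  rw [h1, mul_add]
  gcongr ?_ + ?_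
  · rw [← ENNReal.ofReal_mul (by positivity), hl]
    apply le_of_eq
    congr 1
    field_simp
  · calc _ ≤ ENNReal.ofReal δ⁻¹ * (ENNReal.ofReal C * (ENNReal.ofReal (2 * l / (hi - lo)) *
          ∫⁻ x in Ioo lo hi, ENNReal.ofReal |v x - α|)) := by gcongr
      _ = _ := by
        rw [← mul_assoc, ← mul_assoc, ← ENNReal.ofReal_mul (by positivity),
          ← ENNReal.ofReal_mul (by positivity), hl]
        congr 2
        field_simp

lemma eventually_kappa_le_Gfun_add {a s D α β : ℝ} {V : ℝ → ℝ} (ha : a ∈ Ioo (-1 : ℝ) 0)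
    (hs : s = (1 - a) / 2) (hD : 0 < D) (hαβ : α ≤ β) (hV0 : ∀ t, 0 ≤ V t) (hVc : Continuous V)
    (hVα : V α = 0) (hVβ : V β = 0) {ε : ℕ → ℝ} (hε : ∀ n, 0 < ε n)
    (hε0 : Tendsto ε atTop (nhds 0)) {v : ℕ → ℝ → ℝ} (hv : ∀ n, Measurable (v n))
    {lo m hi : ℝ} (hlo : lo < m) (hhi : m < hi)
    (hα : Tendsto (fun n => ∫⁻ x in Ioo lo m, ENNReal.ofReal |v n x - α|) atTop (nhds 0))
    (hβ : Tendsto (fun n => ∫⁻ x in Ioo m hi, ENNReal.ofReal |v n x - β|) atTop (nhds 0))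
    {e : ℝ} (he : 0 < e) :
    ∀ᶠ n in atTop, kappa D s α β V ≤ Gfun a s D V (ε n) (Ioo lo hi) (v n) + ENNReal.ofReal e := by
  obtain ⟨ha1, ha0⟩ := ha
  set A : ℝ≥0∞ := ENNReal.ofReal ((β - α) ^ 2 / D) * gag s univ ramp with hA
  have hAt : A ≠ ⊤ := ENNReal.mul_ne_top ENNReal.ofReal_ne_top
    (gag_ramp_ne_top (by linarith) (by linarith))
  obtain ⟨L, hAL, hL⟩ : ∃ L : ℝ, A * ENNReal.ofReal (L ^ (1 - 2 * s)) ≤ ENNReal.ofReal (e / 4) ∧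
      0 < L := by
    have h1 : Tendsto (fun L : ℝ => A * ENNReal.ofReal (L ^ (1 - 2 * s))) atTop (nhds 0) := by
      have h2 : Tendsto (fun L : ℝ => L ^ (1 - 2 * s)) atTop (nhds 0) := by
        have := tendsto_rpow_neg_atTop (y := 2 * s - 1) (by linarith)
        simpa using this
      have h3 := ENNReal.Tendsto.const_mul (ENNReal.tendsto_ofReal h2) (.inr hAt)
      simpa using h3
    exact ((h1.eventually_le_const (by positivity)).and (eventually_gt_atTop 0)).exists
  obtain ⟨C, hC, hVη⟩ := exists_linear_bound_of_continuous hVc (α := α) (β := β) hVα hVβ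
    (η := e / 4 / (2 * L)) (by positivity)
  have hsmall : ∀ (c : ℝ) {f : ℕ → ℝ≥0∞}, Tendsto f atTop (nhds 0) →
      ∀ᶠ n in atTop, ENNReal.ofReal c * f n ≤ ENNReal.ofReal (e / 8) := by
    intro c f hf
    have h := ENNReal.Tendsto.const_mul (a := ENNReal.ofReal c) hf (.inr ENNReal.ofReal_ne_top)
    rw [mul_zero] at h
    exact h.eventually_le_const (by positivity)
  have hr : 0 < (1 - a) / (-a) := div_pos (by linarith) (by linarith)
  have hδ0 : Tendsto (fun n => ε n ^ ((1 - a) / (-a)) * L) atTop (nhds 0) := by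
    have := (hε0.rpow_const (.inr hr.le)).mul_const L
    rwa [Real.zero_rpow hr.ne', zero_mul] at this
  filter_upwards [hsmall (C * (2 * L / (m - lo))) hα, hsmall (C * (2 * L / (hi - m))) hβ,
    hδ0.eventually_le_const (sub_pos.2 hlo), hδ0.eventually_le_const (sub_pos.2 hhi)]
    with n hn1 hn2 hn3 hn4
  set δ := ε n ^ ((1 - a) / (-a)) with hδ
  have hδp : 0 < δ := Real.rpow_pos_of_pos (hε n) _
  obtain ⟨l, hl⟩ : ∃ l, l = δ * L := ⟨_, rfl⟩
  rw [← hl] at hn3 hn4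
  have hlp : 0 < l := hl ▸ mul_pos hδp hL
  obtain ⟨p, hp1, hp2, hp3⟩ := exists_window (fun x => ENNReal.ofReal |v n x - α|) hlp hn3
  obtain ⟨q, hq1, hq2, hq3⟩ := exists_window (fun x => ENNReal.ofReal |v n x - β|) hlp hn4
  have hpq : p ≤ q := by linarith
  set u := splice α β l p q (v n)
  have hubot : Tendsto u atBot (nhds α) := tendsto_const_nhds.congr' <| by
    filter_upwards [eventually_le_atBot p] with x hx using (splice_of_le hlp hpq hx).symm
  have hutop : Tendsto u atTop (nhds β) := tendsto_const_nhds.congr' <| by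
    filter_upwards [eventually_ge_atTop (q + l)] with x hx using (splice_of_ge hαβ hlp hx).symm
  refine (kappa_le_Gfun_univ ha0 hs hD (hε n) (measurable_splice (hv n)) hubot hutop).trans ?_
  have hgag := gag_splice_le (v := v n) s hαβ hlp hpq hp1 hq2
  have hpot := lintegral_potential_splice_le hV0 hVα hVβ (hv n) hαβ hlp
    (hp2.trans hq1) hp1 hq2 hC hVη
  have hη : 0 ≤ e / 4 / (2 * L) := by positivity
  have hw1 := lintegral_window_le hη hC hδp hL hl hlo hp3
  have hw2 := lintegral_window_le hη hC hδp hL hl hhi hq3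
  have hηL : e / 4 / (2 * L) * L = e / 8 := by field_simp; norm_num
  rw [hηL] at hw1 hw2
  have htr : ∀ r, ENNReal.ofReal (ε n ^ (1 - a) / D) * gag s univ (transition α β l r) ≤
      ENNReal.ofReal (e / 4) := by
    intro r
    refine le_trans (le_of_eq ?_) hAL
    have hεn := hε n
    rw [gag_transition s α β hlp, hA, mul_right_comm, ← mul_assoc,
      ← ENNReal.ofReal_mul (by positivity), ← ENNReal.ofReal_mul (by positivity), hl,
      Real.mul_rpow hδp.le hL.le]
    have : ε n ^ (1 - a) * δ ^ (1 - 2 * s) = 1 := by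
      rw [hδ, ← Real.rpow_mul hεn.le, ← Real.rpow_add hεn]
      convert Real.rpow_zero (ε n) using 2
      have := ha0.ne
      rw [hs]
      field_simp
      ring
    congr 2
    linear_combination (L ^ (1 - 2 * s) * (β - α) ^ 2 / D) * this
  unfold Gfun
  rw [Measure.restrict_univ, Real.rpow_neg (hε n).le, ← hδ]
  have hsum : (ENNReal.ofReal (e / 4) + ENNReal.ofReal (e / 4)) +
      ((ENNReal.ofReal (e / 8) + ENNReal.ofReal (e / 8)) +
        (ENNReal.ofReal (e / 8) + ENNReal.ofReal (e / 8))) = ENNReal.ofReal e := by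
    rw [← ENNReal.ofReal_add (by positivity) (by positivity),
      ← ENNReal.ofReal_add (by positivity) (by positivity),
      ← ENNReal.ofReal_add (by positivity) (by positivity),
      ← ENNReal.ofReal_add (by positivity) (by positivity)]
    congr 1
    ring
  refine (add_le_add (mul_le_mul_right hgag _) (mul_le_mul_right hpot _)).trans ?_
  rw [mul_add, mul_add (ENNReal.ofReal δ⁻¹), add_add_add_comm]
  refine add_le_add le_rfl ?_
  rw [mul_add, mul_add, ← hsum]
  exact add_le_add (add_le_add (htr p) (htr q))
    (add_le_add (hw1.trans (add_le_add le_rfl hn1)) (hw2.trans (add_le_add le_rfl hn2)))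

lemma setLIntegral_Ioo_comp_neg (lo hi : ℝ) (g : ℝ → ℝ≥0∞) :
    ∫⁻ x in Ioo (-hi) (-lo), g (-x) = ∫⁻ x in Ioo lo hi, g x := by
  have h2 := setLIntegral_comp_affine (neg_ne_zero.2 one_ne_zero) 0 (Ioo lo hi) g
  simpa using h2

lemma Gfun_comp_neg (a s D : ℝ) (V : ℝ → ℝ) (ε lo hi : ℝ) (v : ℝ → ℝ) :
    Gfun a s D V ε (Ioo (-hi) (-lo)) (fun x => v (-x)) = Gfun a s D V ε (Ioo lo hi) v := by
  have h1 := gag_comp_affine s (neg_ne_zero.2 one_ne_zero) 0 (Ioo lo hi) v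
  simp only [add_zero, neg_mul, one_mul, abs_neg, abs_one, Real.one_rpow, Set.neg_preimage, Set.neg_Ioo,
    ENNReal.ofReal_one] at h1
  rw [Gfun, Gfun, h1, setLIntegral_Ioo_comp_neg lo hi fun x => ENNReal.ofReal (V (v x))]

lemma sum_Gfun_le {ι : Type*} (S : Finset ι) {J : ι → Set ℝ} {E : Set ℝ}
    (hd : (S : Set ι).PairwiseDisjoint J) (hJm : ∀ i ∈ S, MeasurableSet (J i))
    (hJE : ∀ i ∈ S, J i ⊆ E) (a s D : ℝ) (V : ℝ → ℝ) (ε : ℝ) (v : ℝ → ℝ) :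
    ∑ i ∈ S, Gfun a s D V ε (J i) v ≤ Gfun a s D V ε E v := by
  have hU : ∀ f : ℝ → ℝ≥0∞, ∑ i ∈ S, ∫⁻ x in J i, f x ≤ ∫⁻ x in E, f x := by
    intro f
    rw [← lintegral_biUnion_finset hd hJm]
    exact lintegral_mono_set (iUnion₂_subset hJE)
  unfold Gfun
  rw [Finset.sum_add_distrib, ← Finset.mul_sum, ← Finset.mul_sum]
  gcongr
  · refine le_trans (Finset.sum_le_sum fun i hi => ?_) (hU _)
    exact lintegral_mono fun x => lintegral_mono_set (hJE i hi)
  · exact hU _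

/- STATEMENT 15: Γ-liminf inequality. If w is a step function on E = (a₀, b₀) with
values in {α', β'} and exactly N jumps, then for every ε_n → 0⁺ and every v_n → w in
L¹(E), one has N·κ_s ≤ liminf G_{ε_n}[v_n, E]. -/
theorem stmt_15 (a s D α' β' : ℝ) (V : ℝ → ℝ)
    (ha : a ∈ Set.Ioo (-1 : ℝ) 0) (hs : s = (1 - a) / 2) (hD : 0 < D) (hαβ : α' < β')
    (hV0 : ∀ t, 0 ≤ V t) (hVc : Continuous V)
    (hVz : ∀ t, V t = 0 ↔ t = α' ∨ t = β')
    (a₀ b₀ : ℝ) (hab : a₀ < b₀) (N : ℕ)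
    (w : ℝ → ℝ) (t : ℕ → ℝ) (cvals : ℕ → ℝ)
    (ht0 : t 0 = a₀) (htN : t (N + 1) = b₀) (htmono : ∀ i ≤ N, t i < t (i + 1))
    (hc : ∀ i ≤ N, cvals i = α' ∨ cvals i = β')
    (hcjump : ∀ i < N, cvals i ≠ cvals (i + 1))
    (hw : ∀ i ≤ N, ∀ x ∈ Ioo (t i) (t (i + 1)), w x = cvals i)
    (ε : ℕ → ℝ) (hε : ∀ n, 0 < ε n) (hε0 : Tendsto ε atTop (nhds 0))
    (v : ℕ → ℝ → ℝ) (hmeas : ∀ n, Measurable (v n))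
    (hL1 : Tendsto (fun n => ∫⁻ x in Ioo a₀ b₀, ENNReal.ofReal |v n x - w x|)
      atTop (nhds 0)) :
    (N : ℝ≥0∞) * kappa D s α' β' V ≤
      Filter.liminf (fun n => Gfun a s D V (ε n) (Ioo a₀ b₀) (v n)) atTop := by
  have hVα : V α' = 0 := (hVz α').2 (.inl rfl)
  have hVβ : V β' = 0 := (hVz β').2 (.inr rfl)
  have htm : ∀ i j, i ≤ j → j ≤ N + 1 → t i ≤ t j := by
    intro i j hij
    induction j, hij using Nat.le_induction with
    | base => exact fun _ => le_rfl
    | succ k _ ih => exact fun h => (ih (by omega)).trans (htmono k (by omega)).le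
  set J : ℕ → Set ℝ := fun i => Ioo ((t i + t (i + 1)) / 2) ((t (i + 1) + t (i + 2)) / 2) with hJ
  have hJE : ∀ i ∈ Finset.range N, J i ⊆ Ioo a₀ b₀ := by
    intro i hi x hx
    have hi' := Finset.mem_range.1 hi
    have h1 := htm 0 i (by omega) (by omega)
    have h2 := htm (i + 2) (N + 1) (by omega) le_rfl
    have h3 := htmono i (by omega)
    have h4 := htmono (i + 1) (by omega)
    exact ⟨by linarith [hx.1], by linarith [hx.2]⟩
  have hd : (Finset.range N : Set ℕ).PairwiseDisjoint J := by
    have key : ∀ i j, i < j → j < N → Disjoint (J i) (J j) := by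
      intro i j hij hj
      rw [Set.disjoint_left]
      intro x hx hy
      have h1 := htm (i + 1) j (by omega) (by omega)
      have h2 := htm (i + 2) (j + 1) (by omega) (by omega)
      linarith [hx.2, hy.1]
    intro i hi j hj hij
    rw [Finset.mem_coe, Finset.mem_range] at hi hj
    rcases lt_or_gt_of_ne hij with h | h
    · exact key i j h hj
    · exact (key j i h hi).symm
  have hconv : ∀ i ≤ N, ∀ lo hi, t i ≤ lo → hi ≤ t (i + 1) → Tendsto
      (fun n => ∫⁻ x in Ioo lo hi, ENNReal.ofReal |v n x - cvals i|) atTop (nhds 0) := by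
    intro i hi lo hi' hlo hhi
    refine tendsto_of_tendsto_of_tendsto_of_le_of_le tendsto_const_nhds hL1
      (fun _ => zero_le) fun n => ?_
    calc ∫⁻ x in Ioo lo hi', ENNReal.ofReal |v n x - cvals i|
        = ∫⁻ x in Ioo lo hi', ENNReal.ofReal |v n x - w x| := by
          refine setLIntegral_congr_fun measurableSet_Ioo fun x hx => ?_
          simp only [hw i hi x ⟨hlo.trans_lt hx.1, hx.2.trans_le hhi⟩]
      _ ≤ _ := by
          apply lintegral_mono_set
          have h1 := htm 0 i (by omega) (by omega)
          have h2 := htm (i + 1) (N + 1) (by omega) le_rfl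
          exact Ioo_subset_Ioo (by linarith) (by linarith)
  have hjump : ∀ e : ℝ, 0 < e → ∀ i ∈ Finset.range N, ∀ᶠ n in atTop,
      kappa D s α' β' V ≤ Gfun a s D V (ε n) (J i) (v n) + ENNReal.ofReal e := by
    intro e he i hi
    have hi' := Finset.mem_range.1 hi
    have h3 := htmono i (by omega)
    have h4 : t (i + 1) < t (i + 2) := htmono (i + 1) (by omega)
    have hlo : (t i + t (i + 1)) / 2 < t (i + 1) := by linarith
    have hhi : t (i + 1) < (t (i + 1) + t (i + 2)) / 2 := by linarith
    have c1 := hconv i (by omega) ((t i + t (i + 1)) / 2) (t (i + 1)) (by linarith) le_rfl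
    have c2 := hconv (i + 1) (by omega) (t (i + 1)) ((t (i + 1) + t (i + 2)) / 2) le_rfl
      (by change _ ≤ t (i + 2); linarith)
    have hne := hcjump i hi'
    rcases hc i (by omega) with e1 | e1 <;> rcases hc (i + 1) (by omega) with e2 | e2
    · exact absurd (e1.trans e2.symm) hne
    · rw [e1] at c1
      rw [e2] at c2
      exact eventually_kappa_le_Gfun_add ha hs hD hαβ.le hV0 hVc hVα hVβ hε hε0 hmeas hlo hhi
        c1 c2 he
    · rw [e1] at c1
      rw [e2] at c2
      have h := eventually_kappa_le_Gfun_add (v := fun n x => v n (-x)) ha hs hD hαβ.le hV0 hVc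
        hVα hVβ hε hε0 (fun n => (hmeas n).comp measurable_neg) (neg_lt_neg hhi) (neg_lt_neg hlo)
        (c2.congr fun n => (setLIntegral_Ioo_comp_neg _ _
          (fun y => ENNReal.ofReal |v n y - α'|)).symm)
        (c1.congr fun n => (setLIntegral_Ioo_comp_neg _ _
          (fun y => ENNReal.ofReal |v n y - β'|)).symm) he
      simpa only [Gfun_comp_neg] using h
    · exact absurd (e1.trans e2.symm) hne
  refine ENNReal.le_of_forall_pos_le_add fun r hr _ => ?_
  have hr' : (0 : ℝ) < r / (N + 1) := by positivity
  have hev : ∀ᶠ n in atTop, (N : ℝ≥0∞) * kappa D s α' β' V - r ≤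
      Gfun a s D V (ε n) (Ioo a₀ b₀) (v n) := by
    filter_upwards [(Filter.eventually_all_finset _).2 (hjump _ hr')] with n hn
    rw [tsub_le_iff_right]
    calc (N : ℝ≥0∞) * kappa D s α' β' V
        = ∑ i ∈ Finset.range N, kappa D s α' β' V := by simp
      _ ≤ ∑ i ∈ Finset.range N,
          (Gfun a s D V (ε n) (J i) (v n) + ENNReal.ofReal (r / (N + 1))) := Finset.sum_le_sum hn
      _ = ∑ i ∈ Finset.range N, Gfun a s D V (ε n) (J i) (v n) +
          N * ENNReal.ofReal (r / (N + 1)) := by simp [Finset.sum_add_distrib]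
      _ ≤ _ := by
        gcongr
        · exact sum_Gfun_le _ hd (fun _ _ => measurableSet_Ioo) hJE a s D V (ε n) (v n)
        · rw [← ENNReal.ofReal_natCast, ← ENNReal.ofReal_mul (by positivity),
            ← ENNReal.ofReal_coe_nnreal]
          apply ENNReal.ofReal_le_ofReal
          rw [← mul_div_assoc, div_le_iff₀ (by positivity)]
          nlinarith [r.coe_nonneg]
  exact tsub_le_iff_right.1 (Filter.le_liminf_of_le (by isBoundedDefault) hev)
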